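/- arXiv:2605.16838 — 2 statements merged into one kernel-verified Lean document; each statement's English description precedes it below -/
import Mathlib

section
/- Let G be a finite simple well-covered graph with independence number α(G) = r. Then the W-index of G satisfies w(G) = min{ |F_G(S)| : S is an independent set of G with |S| = r − 1 }. -/
open Finset
open scoped Classical

/-- `S` is an independent set of the graph `G`. -/
def IsIndep {V : Type*} (G : SimpleGraph V) (S : Finset V) : Prop :=
  ∀ ⦃x⦄, x ∈ S → ∀ ⦃y⦄, y ∈ S → x ≠ y → ¬ G.Adj x y

/-- The independence number `α(G)` of a finite graph `G`. -/
noncomputable def alpha {V : Type*} [Fintype V] (G : SimpleGraph V) : ℕ :=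
  Finset.univ.sup fun S : Finset V => if IsIndep G S then S.card else 0

/-- `S` is a maximum independent set of `G`. -/
def IsMaxIndep {V : Type*} [Fintype V] (G : SimpleGraph V) (S : Finset V) : Prop :=
  IsIndep G S ∧ S.card = alpha G

/-- `S` is a maximal (inclusion-wise) independent set of `G`. -/
def IsMaximalIndep {V : Type*} [DecidableEq V] (G : SimpleGraph V) (S : Finset V) : Prop :=
  IsIndep G S ∧ ∀ x, x ∉ S → ¬ IsIndep G (insert x S)

/-- `G` is well-covered: every maximal independent set has cardinality `α(G)`. -/
def WellCovered {V : Type*} [Fintype V] [DecidableEq V] (G : SimpleGraph V) : Prop :=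
  ∀ S : Finset V, IsMaximalIndep G S → S.card = alpha G

/-- `G ∈ W_p`: `|V(G)| ≥ p` and every `p` pairwise disjoint independent sets extend to
`p` pairwise disjoint maximum independent sets. -/
def MemW {V : Type*} [Fintype V] (G : SimpleGraph V) (p : ℕ) : Prop :=
  p ≤ Fintype.card V ∧
    ∀ A : Fin p → Finset V, (∀ i, IsIndep G (A i)) →
      (∀ i j, i ≠ j → Disjoint (A i) (A j)) →
      ∃ M : Fin p → Finset V, (∀ i, IsMaxIndep G (M i)) ∧
        (∀ i j, i ≠ j → Disjoint (M i) (M j)) ∧ ∀ i, A i ⊆ M i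

/-- The `W`-index of `G`: the largest `p` with `G ∈ W_p`. -/
noncomputable def wIndex {V : Type*} [Fintype V] (G : SimpleGraph V) : ℕ :=
  sSup {p : ℕ | MemW G p}

/-- The fiber `F_G(S)`: the vertices `x ∉ S` with `S ∪ {x}` a maximum independent set. -/
noncomputable def fiber {V : Type*} [Fintype V] [DecidableEq V]
    (G : SimpleGraph V) (S : Finset V) : Finset V :=
  Finset.univ.filter fun x => x ∉ S ∧ IsMaxIndep G (insert x S)

/-- `G` is `α`-critical: deleting any edge increases the independence number. -/
def AlphaCritical {V : Type*} [Fintype V] (G : SimpleGraph V) : Prop :=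
  ∀ x y, G.Adj x y → alpha G < alpha (G.deleteEdges {s(x, y)})

/-- `H` is `K_t`-saturated: `H` is `K_t`-free but adding any missing edge creates a `K_t`. -/
def KSaturated {V : Type*} [Fintype V] (H : SimpleGraph V) (t : ℕ) : Prop :=
  (∀ Q : Finset V, ¬ H.IsNClique t Q) ∧
    ∀ x y : V, x ≠ y → ¬ H.Adj x y →
      ∃ Q : Finset V, (H ⊔ SimpleGraph.fromEdgeSet {s(x, y)}).IsNClique t Q

/-- `Q` is an inclusion-maximal clique of `H`. -/
def IsMaximalClique {V : Type*} [DecidableEq V] (H : SimpleGraph V) (Q : Finset V) : Prop :=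
  H.IsClique (Q : Set V) ∧ ∀ x, x ∉ Q → ¬ H.IsClique ((insert x Q : Finset V) : Set V)

/-- The `(r-1)`-clique-codegree of `Q` in `H`: the number of vertices extending `Q`
to an `r`-clique of `H`. -/
noncomputable def codeg {V : Type*} [Fintype V] [DecidableEq V]
    (H : SimpleGraph V) (r : ℕ) (Q : Finset V) : ℕ :=
  (Finset.univ.filter fun x => x ∉ Q ∧ H.IsNClique r (insert x Q)).card

/-- The minimum `(r-1)`-clique-codegree `δ^cl_{r-1}(H)`. -/
noncomputable def minCliqueCodeg {V : Type*} [Fintype V] [DecidableEq V]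
    (H : SimpleGraph V) (r : ℕ) : ℕ :=
  sInf {m : ℕ | ∃ Q : Finset V, H.IsNClique (r - 1) Q ∧ codeg H r Q = m}

/-- The vertex set of the localization `G_S = G - N_G[S]`. -/
noncomputable def localVerts {V : Type*} [Fintype V] (G : SimpleGraph V) (S : Finset V) :
    Finset V :=
  Finset.univ.filter fun v => v ∉ S ∧ ∀ s ∈ S, ¬ G.Adj s v

/-- The localization `G_S = G - N_G[S]`, as an induced subgraph. -/
noncomputable def localize {V : Type*} [Fintype V] (G : SimpleGraph V) (S : Finset V) :
    SimpleGraph {v : V // v ∈ localVerts G S} :=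
  SimpleGraph.comap (fun v => (v : V)) G

/-- The vertex set of the edge-localization `G_{ab} = G - (N_G(a) ∪ N_G(b))`. -/
noncomputable def edgeVerts {V : Type*} [Fintype V] (G : SimpleGraph V) (a b : V) : Finset V :=
  Finset.univ.filter fun v => ¬ G.Adj a v ∧ ¬ G.Adj b v

/-- The edge-localization `G_{ab} = G - (N_G(a) ∪ N_G(b))`, as an induced subgraph. -/
noncomputable def edgeLocalize {V : Type*} [Fintype V] (G : SimpleGraph V) (a b : V) :
    SimpleGraph {v : V // v ∈ edgeVerts G a b} :=
  SimpleGraph.comap (fun v => (v : V)) G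

theorem IsIndep.mono {V : Type*} {G : SimpleGraph V} {S T : Finset V} (hT : IsIndep G T)
    (h : S ⊆ T) : IsIndep G S :=
  fun _ hx _ hy => hT (h hx) (h hy)

theorem IsIndep.singleton {V : Type*} (G : SimpleGraph V) (x : V) : IsIndep G {x} := by
  intro a ha b hb hab
  rw [Finset.mem_singleton] at ha hb
  exact absurd (ha.trans hb.symm) hab

theorem IsIndep.empty {V : Type*} (G : SimpleGraph V) : IsIndep G ∅ := by
  intro a ha
  simp at ha

theorem IsIndep.card_le_alpha {V : Type*} [Fintype V] {G : SimpleGraph V} {S : Finset V}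
    (hS : IsIndep G S) : S.card ≤ alpha G := by
  have h := Finset.le_sup (f := fun S : Finset V => if IsIndep G S then S.card else 0)
    (Finset.mem_univ S)
  rwa [if_pos hS] at h

/-- In a well-covered graph, independent sets extend to independent sets of every size up to the
independence number. -/
theorem WellCovered.exists_superset_card_eq {V : Type*} [Fintype V] [DecidableEq V]
    {G : SimpleGraph V} (hwc : WellCovered G) {S : Finset V} (hS : IsIndep G S) {k : ℕ}
    (hSk : S.card ≤ k) (hk : k ≤ alpha G) : ∃ T, S ⊆ T ∧ IsIndep G T ∧ T.card = k := by
  obtain ⟨M, hSM, hM⟩ := Finite.exists_le_maximal (p := IsIndep G) hS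
  have hcard : M.card = alpha G :=
    hwc M ⟨hM.prop, fun x hx h => hx (hM.le_of_ge h (Finset.subset_insert x M)
      (Finset.mem_insert_self x M))⟩
  obtain ⟨T, hST, hTM, hT⟩ := Finset.exists_subsuperset_card_eq hSM hSk (hcard ▸ hk)
  exact ⟨T, hST, hM.prop.mono hTM, hT⟩

/-- A fiber is a clique. -/
theorem eq_of_mem_fiber_of_not_adj {V : Type*} [Fintype V] [DecidableEq V]
    {G : SimpleGraph V} {S : Finset V} {x y : V} (hx : x ∈ fiber G S) (hy : y ∈ fiber G S)
    (hxy : ¬ G.Adj x y) : x = y := by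
  by_contra hne
  obtain ⟨hxS, hxi, hxc⟩ := (Finset.mem_filter.mp hx).2
  obtain ⟨hyS, hyi, -⟩ := (Finset.mem_filter.mp hy).2
  have hind : IsIndep G (insert y (insert x S)) := by
    intro a ha b hb hab hadj
    have h1 := @hxi a
    have h2 := @hyi a
    simp only [Finset.mem_insert] at ha hb h1 h2
    have := hadj.symm
    grind
  have hle := hind.card_le_alpha
  rw [Finset.card_insert_of_notMem (by grind), hxc] at hle
  omega

theorem MemW.le_card_fiber {V : Type*} [Fintype V] [DecidableEq V] {G : SimpleGraph V} {p : ℕ}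
    (hp : MemW G p) {S : Finset V} (hS : IsIndep G S) (hcard : S.card = alpha G - 1) :
    p ≤ (fiber G S).card := by
  by_contra! hlt
  obtain ⟨v⟩ : Nonempty V := Fintype.card_pos_iff.mp (by have := hp.1; omega)
  have hpos : 1 ≤ alpha G := (IsIndep.singleton G v).card_le_alpha
  obtain ⟨q, rfl⟩ : ∃ q, p = q + 1 := ⟨p - 1, by omega⟩
  let e := (fiber G S).equivFin
  let A : Fin (q + 1) → Finset V :=
    Fin.cons S fun i => (fiber G S).filter fun x => ∃ hx : x ∈ fiber G S, (e ⟨x, hx⟩ : ℕ) = i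
  have hA0 : A 0 = S := rfl
  have hAs (i : Fin q) : A i.succ =
      (fiber G S).filter fun x => ∃ hx : x ∈ fiber G S, (e ⟨x, hx⟩ : ℕ) = i := rfl
  have hdS (i : Fin q) : Disjoint S (A i.succ) := by
    rw [Finset.disjoint_left, hAs]
    intro x hx hx'
    exact (Finset.mem_filter.mp (Finset.mem_filter.mp hx').1).2.1 hx
  obtain ⟨M, hM, hdisj, hAM⟩ := hp.2 A
    (by
      intro i
      refine Fin.cases hS (fun i => ?_) i
      rw [hAs]
      intro x hx y hy hxy
      obtain ⟨hx, hx'⟩ := (Finset.mem_filter.mp hx).2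
      obtain ⟨hy, hy'⟩ := (Finset.mem_filter.mp hy).2
      have := e.injective (Fin.ext (hx'.trans hy'.symm))
      exact absurd (congrArg Subtype.val this) hxy)
    (by
      intro i j
      refine Fin.cases ?_ (fun i => ?_) i <;> refine Fin.cases ?_ (fun j => ?_) j
      · exact fun h => absurd rfl h
      · exact fun _ => hdS j
      · exact fun _ => (hdS i).symm
      · intro hij
        rw [Finset.disjoint_left, hAs, hAs]
        intro x hx hy
        obtain ⟨hx, hx'⟩ := (Finset.mem_filter.mp hx).2
        obtain ⟨_, hy'⟩ := (Finset.mem_filter.mp hy).2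
        exact hij (congrArg Fin.succ (Fin.ext (hx'.symm.trans hy'))))
  obtain ⟨x, hxM, hxS⟩ := Finset.exists_mem_notMem_of_card_lt_card
    (s := S) (t := M 0) (by rw [(hM 0).2]; omega)
  have hins : insert x S = M 0 := by
    refine Finset.eq_of_subset_of_card_le (Finset.insert_subset hxM (hAM 0)) ?_
    rw [(hM 0).2, Finset.card_insert_of_notMem hxS]
    omega
  have hxF : x ∈ fiber G S :=
    Finset.mem_filter.mpr ⟨Finset.mem_univ x, hxS, hins ▸ hM 0⟩
  have hlt' : (e ⟨x, hxF⟩ : ℕ) < q := by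
    have := (e ⟨x, hxF⟩).isLt
    omega
  have hxA : x ∈ A (Fin.succ ⟨_, hlt'⟩) := by
    rw [hAs]
    exact Finset.mem_filter.mpr ⟨hxF, hxF, rfl⟩
  exact Finset.disjoint_left.mp (hdisj 0 _ (Fin.succ_ne_zero _).symm) hxM (hAM _ hxA)

theorem WellCovered.memW_of_le_card_fiber {V : Type*} [Fintype V] [DecidableEq V]
    {G : SimpleGraph V} (hwc : WellCovered G) {p : ℕ}
    (hp : ∀ S, IsIndep G S → S.card = alpha G - 1 → p ≤ (fiber G S).card) : MemW G p := by
  constructor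
  · obtain ⟨S, -, hS, hcard⟩ := hwc.exists_superset_card_eq (IsIndep.empty G)
      (Nat.zero_le (alpha G - 1)) (Nat.sub_le _ _)
    exact (hp S hS hcard).trans (Finset.card_le_univ _)
  intro A hA hAdisj
  obtain ⟨M, hAM, hM⟩ := Finite.exists_le_maximal
    (p := fun M : Fin p → Finset V =>
      (∀ i, IsIndep G (M i)) ∧ ∀ i j, i ≠ j → Disjoint (M i) (M j)) ⟨hA, hAdisj⟩
  obtain ⟨hind, hdisj⟩ := hM.prop
  refine ⟨M, fun i => ⟨hind i, ?_⟩, hdisj, hAM⟩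
  by_contra hne
  have hlt : (M i).card < alpha G := lt_of_le_of_ne (hind i).card_le_alpha hne
  obtain ⟨S, hMS, hS, hcard⟩ := hwc.exists_superset_card_eq (hind i)
    (Nat.le_sub_one_of_lt hlt) (Nat.sub_le _ _)
  have hcover : ∀ x ∈ fiber G S, ∃ j, j ≠ i ∧ x ∈ M j := by
    intro x hx
    obtain ⟨hxS, hxi, -⟩ := (Finset.mem_filter.mp hx).2
    by_contra! hno
    have hxi' : x ∉ M i := fun h => hxS (hMS h)
    have hle : M ≤ Function.update M i (insert x (M i)) := by
      rw [le_update_iff]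
      exact ⟨Finset.subset_insert _ _, fun _ _ => le_rfl⟩
    have hge := hM.le_of_ge (y := Function.update M i (insert x (M i))) ⟨?_, ?_⟩ hle i
    · rw [Function.update_self] at hge
      exact hxi' (hge (Finset.mem_insert_self _ _))
    · intro j
      by_cases hj : j = i
      · subst hj
        rw [Function.update_self]
        exact hxi.mono (Finset.insert_subset_insert x hMS)
      · rw [Function.update_of_ne hj]
        exact hind j
    · intro j k hjk
      by_cases hj : j = i
      · subst hj
        rw [Function.update_self, Function.update_of_ne hjk.symm, Finset.disjoint_insert_left]
        exact ⟨hno k hjk.symm, hdisj _ _ hjk⟩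
      · rw [Function.update_of_ne hj]
        by_cases hk : k = i
        · subst hk
          rw [Function.update_self, Finset.disjoint_insert_right]
          exact ⟨hno j hj, hdisj _ _ hjk⟩
        · rw [Function.update_of_ne hk]
          exact hdisj _ _ hjk
  have : Nonempty (Fin p) := ⟨i⟩
  choose! f hfi hf using hcover
  have hle : (fiber G S).card ≤ (Finset.univ.erase i).card := by
    refine Finset.card_le_card_of_injOn f
      (fun x hx => Finset.mem_coe.mpr (Finset.mem_erase.mpr ⟨hfi x hx, Finset.mem_univ _⟩)) ?_
    intro x hx y hy hxy
    by_contra hne'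
    refine hne' (eq_of_mem_fiber_of_not_adj hx hy (hind (f x) (hf x hx) ?_ hne'))
    rw [hxy]
    exact hf y hy
  rw [Finset.card_erase_of_mem (Finset.mem_univ i), Finset.card_univ, Fintype.card_fin] at hle
  have := hp S hS hcard
  have := i.isLt
  omega

/-- Exact `W`-index via fibers. -/
theorem wIndex_eq_min_fiber {V : Type*} [Fintype V] [DecidableEq V]
    (G : SimpleGraph V) (r : ℕ) (hwc : WellCovered G) (halpha : alpha G = r) :
    wIndex G =
      sInf {m : ℕ | ∃ S : Finset V, IsIndep G S ∧ S.card = r - 1 ∧ (fiber G S).card = m} := by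
  subst halpha
  obtain ⟨T, -, hT, hTcard⟩ := hwc.exists_superset_card_eq (IsIndep.empty G)
    (Nat.zero_le (alpha G - 1)) (Nat.sub_le _ _)
  obtain ⟨S, hS, hcard, hmin⟩ := Nat.sInf_mem
    (s := {m : ℕ | ∃ S : Finset V, IsIndep G S ∧ S.card = alpha G - 1 ∧ (fiber G S).card = m})
    ⟨_, T, hT, hTcard, rfl⟩
  refine IsGreatest.csSup_eq ⟨?_, fun p hp => ?_⟩
  · exact hwc.memW_of_le_card_fiber fun S hS hcard => Nat.sInf_le ⟨S, hS, hcard, rfl⟩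
  · rw [← hmin]
    exact MemW.le_card_fiber hp hS hcard
end

section
/- Let G be a finite simple graph with independence number α(G) = r. Then G is α-critical if and only if every edge of G lies inside some fiber, i.e., E(G) equals the union, over all independent sets S of G with |S| = r − 1, of the set of all 2-element subsets of F_G(S). -/
open Finset
open scoped Classical

theorem exists_isIndep_of_lt_alpha {V : Type*} [Fintype V] {G : SimpleGraph V} {n : ℕ}
    (h : n < alpha G) : ∃ S : Finset V, IsIndep G S ∧ n < S.card := by
  obtain ⟨S, -, hS⟩ := Finset.lt_sup_iff.mp h
  by_cases hi : IsIndep G S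
  · exact ⟨S, hi, by simpa only [if_pos hi] using hS⟩
  · simp [hi] at hS

/-- A set independent in `G - xy` that misses an end of `xy` is independent in `G`. -/
theorem IsIndep.of_deleteEdges {V : Type*} {G : SimpleGraph V} {x y : V} {T U : Finset V}
    (hT : IsIndep (G.deleteEdges {s(x, y)}) T) (hU : U ⊆ T) (hxy : x ∉ U ∨ y ∉ U) :
    IsIndep G U := by
  intro a ha b hb hab hadj
  refine hT (hU ha) (hU hb) hab ?_
  rw [SimpleGraph.deleteEdges_adj]
  refine ⟨hadj, fun h => ?_⟩
  rw [Set.mem_singleton_iff, Sym2.eq_iff] at h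
  grind

/-- Two sets `S ∪ {x}`, `S ∪ {y}` independent in `G` have a union independent in `G - xy`. -/
theorem IsIndep.insert_insert_deleteEdges {V : Type*} [DecidableEq V] {G : SimpleGraph V}
    {x y : V} {S : Finset V} (hx : IsIndep G (insert x S)) (hy : IsIndep G (insert y S)) :
    IsIndep (G.deleteEdges {s(x, y)}) (insert x (insert y S)) := by
  intro a ha b hb hab hadj
  rw [SimpleGraph.deleteEdges_adj, Set.mem_singleton_iff, Sym2.eq_iff] at hadj
  have hx' := @hx a
  have hy' := @hy a
  simp only [Finset.mem_insert] at ha hb hx' hy'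
  grind

theorem mem_fiber {V : Type*} [Fintype V] [DecidableEq V] {G : SimpleGraph V} {S : Finset V}
    {x : V} : x ∈ fiber G S ↔ x ∉ S ∧ IsMaxIndep G (insert x S) := by
  simp [fiber]

theorem alpha_lt_alpha_deleteEdges_of_mem_fiber {V : Type*} [Fintype V] [DecidableEq V]
    {G : SimpleGraph V} {S : Finset V} {x y : V} (hxy : x ≠ y) (hx : x ∈ fiber G S)
    (hy : y ∈ fiber G S) : alpha G < alpha (G.deleteEdges {s(x, y)}) := by
  rw [mem_fiber] at hx hy
  have hle := (hx.2.1.insert_insert_deleteEdges hy.2.1).card_le_alpha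
  rw [Finset.card_insert_of_notMem (by simp [hxy, hx.1]), hy.2.2] at hle
  exact hle

theorem adj_of_mem_fiber {V : Type*} [Fintype V] [DecidableEq V]
    {G : SimpleGraph V} {S : Finset V} {x y : V} (hxy : x ≠ y) (hx : x ∈ fiber G S)
    (hy : y ∈ fiber G S) : G.Adj x y := by
  by_contra hadj
  have hlt := alpha_lt_alpha_deleteEdges_of_mem_fiber hxy hx hy
  rw [SimpleGraph.deleteEdges_eq_self.mpr (by simpa using hadj)] at hlt
  exact lt_irrefl _ hlt

theorem exists_mem_fiber_of_alpha_lt {V : Type*} [Fintype V] [DecidableEq V]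
    {G : SimpleGraph V} {x y : V} (hxy : x ≠ y)
    (h : alpha G < alpha (G.deleteEdges {s(x, y)})) :
    ∃ S : Finset V, IsIndep G S ∧ S.card = alpha G - 1 ∧ x ∈ fiber G S ∧ y ∈ fiber G S := by
  obtain ⟨T, hT, hcard⟩ := exists_isIndep_of_lt_alpha h
  have hmem : x ∈ T ∧ y ∈ T := by
    by_contra hnot
    have := (hT.of_deleteEdges subset_rfl (not_and_or.mp hnot)).card_le_alpha
    omega
  obtain ⟨hxT, hyT⟩ := hmem
  have hix : IsIndep G (T.erase x) := hT.of_deleteEdges (T.erase_subset x) (by simp)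
  have hiy : IsIndep G (T.erase y) := hT.of_deleteEdges (T.erase_subset y) (by simp)
  have hcx := Finset.card_erase_add_one hxT
  have hcy := Finset.card_erase_add_one hyT
  have hle := hix.card_le_alpha
  have hyx : y ∈ T.erase x := Finset.mem_erase.mpr ⟨hxy.symm, hyT⟩
  have hxy' : x ∈ T.erase y := Finset.mem_erase.mpr ⟨hxy, hxT⟩
  have hcS := Finset.card_erase_add_one hyx
  refine ⟨(T.erase x).erase y, hT.of_deleteEdges
    ((Finset.erase_subset _ _).trans (Finset.erase_subset _ _)) (by simp), by omega,
    mem_fiber.mpr ⟨by simp, ?_⟩, mem_fiber.mpr ⟨by simp, ?_⟩⟩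
  · rw [Finset.erase_right_comm, Finset.insert_erase hxy']
    exact ⟨hiy, by omega⟩
  · rw [Finset.insert_erase hyx]
    exact ⟨hix, by omega⟩

/-- Fiber cover criterion for `α`-criticality. -/
theorem alphaCritical_iff_fiber_cover {V : Type*} [Fintype V] [DecidableEq V]
    (G : SimpleGraph V) (r : ℕ) (halpha : alpha G = r) :
    AlphaCritical G ↔
      ∀ x y : V, G.Adj x y ↔
        (x ≠ y ∧ ∃ S : Finset V, IsIndep G S ∧ S.card = r - 1 ∧
          x ∈ fiber G S ∧ y ∈ fiber G S) := by
  subst halpha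
  constructor
  · intro hG x y
    constructor
    · exact fun hadj => ⟨hadj.ne, exists_mem_fiber_of_alpha_lt hadj.ne (hG x y hadj)⟩
    · rintro ⟨hxy, S, -, -, hx, hy⟩
      exact adj_of_mem_fiber hxy hx hy
  · intro hcover x y hadj
    obtain ⟨hxy, S, -, -, hx, hy⟩ := (hcover x y).mp hadj
    exact alpha_lt_alpha_deleteEdges_of_mem_fiber hxy hx hy
end
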